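/- Order of composition under vanishing derivatives: if ψ : 𝔻 → ℂ^m is holomorphic with ψ(0)=0 and h : ℂ^m → ℝ is smooth with h ≥ 0, h(0)=0, and h∘ψ does not vanish to infinite order at 0, then there exists an integer k ≥ 1 such that all derivatives of h∘ψ of order < 2k vanish at 0 and Δ^k(h∘ψ)(0) > 0, where Δ is the Laplacian on ℂ ≅ ℝ². -/

import Mathlib

/-- The Laplacian of a function on ℂ ≅ ℝ², Δf = ∂²f/∂x² + ∂²f/∂y². -/
noncomputable def lap (f : ℂ → ℝ) : ℂ → ℝ := fun z =>
  fderiv ℝ (fun w => fderiv ℝ f w 1) z 1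
    + fderiv ℝ (fun w => fderiv ℝ f w Complex.I) z Complex.I

open scoped ContDiff in
/-- If a nonnegative smooth function on the line has vanishing derivatives of order `< n` at `0`,
then its `n`-th derivative at `0` is nonnegative. -/
theorem iteratedDeriv_nonneg_of_forall_lt_eq_zero {g : ℝ → ℝ} (hg : ContDiff ℝ ∞ g)
    (hpos : ∀ t, 0 ≤ g t) {n : ℕ} (hz : ∀ j < n, iteratedDeriv j g 0 = 0) :
    0 ≤ iteratedDeriv n g 0 := by
  rcases n with _ | n
  · simpa using hpos 0
  by_contra! hneg
  have hcont : Continuous (iteratedDeriv (n + 1) g) :=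
    hg.continuous_iteratedDeriv (n + 1) (by exact_mod_cast le_top)
  obtain ⟨ε, hε, hball⟩ := Metric.eventually_nhds_iff.1
    (hcont.continuousAt.eventually_lt continuousAt_const hneg)
  have hx : (0 : ℝ) < ε / 2 := by positivity
  have hgn : ContDiff ℝ (n + 1 : ℕ) g := hg.of_le (by exact_mod_cast le_top)
  obtain ⟨ξ, hξ, heq⟩ := taylor_mean_remainder_lagrange_iteratedDeriv (n := n) hx.ne
    (by exact_mod_cast hgn.contDiffOn)
  have htaylor : taylorWithinEval g n (Set.uIcc 0 (ε / 2)) 0 (ε / 2) = 0 := by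
    rw [taylor_within_apply]
    refine Finset.sum_eq_zero fun j hj => ?_
    have hj' : j < n + 1 := Finset.mem_range.1 hj
    rw [iteratedDerivWithin_eq_iteratedDeriv (n := j), hz j hj', smul_zero]
    · exact uniqueDiffOn_uIcc hx.ne
    · exact (hg.of_le (by exact_mod_cast le_top)).contDiffAt
    · exact Set.left_mem_uIcc
  rw [Set.uIoo_of_lt hx] at hξ
  have hξneg : iteratedDeriv (n + 1) g ξ < 0 := hball (by
    rw [Real.dist_eq, sub_zero, abs_of_pos hξ.1]; linarith [hξ.2])
  rw [htaylor, sub_zero, sub_zero] at heq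
  have hlt : iteratedDeriv (n + 1) g ξ * (ε / 2) ^ (n + 1) / ((n + 1).factorial : ℝ) < 0 :=
    div_neg_of_neg_of_pos (mul_neg_of_neg_of_pos hξneg (by positivity)) (by positivity)
  linarith [hpos (ε / 2)]

open scoped ContDiff in
/-- The space of smooth (in the real sense) complex-valued functions on the plane. -/
def smoothFunctions : Submodule ℂ (ℂ → ℂ) where
  carrier := {f | ContDiff ℝ ∞ f}
  add_mem' {f g} (hf : ContDiff ℝ ∞ f) (hg : ContDiff ℝ ∞ g) := hf.add hg
  zero_mem' := show ContDiff ℝ ∞ fun _ : ℂ => (0 : ℂ) from contDiff_const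
  smul_mem' c f (hf : ContDiff ℝ ∞ f) := hf.const_smul c

namespace smoothFunctions

open scoped ContDiff ComplexConjugate

theorem contDiff (f : smoothFunctions) : ContDiff ℝ ∞ (f : ℂ → ℂ) := f.2

theorem contDiff_nat (f : smoothFunctions) (n : ℕ) : ContDiff ℝ n (f : ℂ → ℂ) :=
  (contDiff f).of_le (by exact_mod_cast le_top)

theorem differentiable (f : smoothFunctions) : Differentiable ℝ (f : ℂ → ℂ) :=
  (contDiff f).differentiable (by simp)

theorem contDiff_fderiv (f : smoothFunctions) : ContDiff ℝ ∞ (fderiv ℝ (f : ℂ → ℂ)) :=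
  (contDiff f).fderiv_right (by simp)

/-- The directional derivative along a fixed vector. -/
noncomputable def dir (v : ℂ) : Module.End ℂ smoothFunctions where
  toFun f := ⟨fun z => fderiv ℝ (f : ℂ → ℂ) z v, (contDiff_fderiv f).clm_apply contDiff_const⟩
  map_add' f g := by
    ext z
    change fderiv ℝ ((f : ℂ → ℂ) + (g : ℂ → ℂ)) z v
      = fderiv ℝ (f : ℂ → ℂ) z v + fderiv ℝ (g : ℂ → ℂ) z v
    rw [fderiv_add (differentiable f z) (differentiable g z)]
    rfl
  map_smul' c f := by
    ext z
    change fderiv ℝ (c • (f : ℂ → ℂ)) z v = c • fderiv ℝ f z v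
    rw [fderiv_const_smul (differentiable f z)]
    rfl

theorem dir_apply (v : ℂ) (f : smoothFunctions) (z : ℂ) :
    (dir v f : ℂ → ℂ) z = fderiv ℝ f z v := rfl

theorem dir_dir_apply (v w : ℂ) (f : smoothFunctions) (z : ℂ) :
    (dir v (dir w f) : ℂ → ℂ) z = fderiv ℝ (fderiv ℝ (f : ℂ → ℂ)) z v w := by
  rw [dir_apply]
  change fderiv ℝ (fun y => fderiv ℝ (f : ℂ → ℂ) y w) z v = _
  rw [fderiv_clm_apply ((contDiff_fderiv f).differentiable (by simp) z)
    (differentiableAt_const w)]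
  simp

theorem commute_dir (v w : ℂ) : Commute (dir v) (dir w) := by
  refine LinearMap.ext fun f => Subtype.ext (funext fun z => ?_)
  change (dir v (dir w f) : ℂ → ℂ) z = (dir w (dir v f) : ℂ → ℂ) z
  rw [dir_dir_apply, dir_dir_apply]
  exact ((contDiff_nat f 2).contDiffAt.isSymmSndFDerivAt (by simp)).eq v w

/-- The Wirtinger derivative `∂/∂z`. -/
noncomputable def dz : Module.End ℂ smoothFunctions :=
  (1 / 2 : ℂ) • (dir 1 + (-Complex.I) • dir Complex.I)

/-- The Wirtinger derivative `∂/∂z̄`. -/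
noncomputable def dzbar : Module.End ℂ smoothFunctions :=
  (1 / 2 : ℂ) • (dir 1 + Complex.I • dir Complex.I)

theorem commute_dz_dzbar : Commute dz dzbar := by
  have h := commute_dir 1 Complex.I
  unfold dz dzbar
  refine Commute.smul_left (Commute.smul_right ?_ _) _
  refine Commute.add_left (Commute.add_right (Commute.refl _) (h.smul_right _)) ?_
  exact (Commute.add_right h.symm ((Commute.refl _).smul_right _)).smul_left _

theorem dir_eq (v : ℂ) : dir v = v • dz + conj v • dzbar := by
  have h : dir v = (v.re : ℂ) • dir 1 + (v.im : ℂ) • dir Complex.I := by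
    refine LinearMap.ext fun f => Subtype.ext (funext fun z => ?_)
    change fderiv ℝ (f : ℂ → ℂ) z v
      = (v.re : ℂ) • fderiv ℝ (f : ℂ → ℂ) z 1 + (v.im : ℂ) • fderiv ℝ (f : ℂ → ℂ) z Complex.I
    have hv : v = v.re • (1 : ℂ) + v.im • Complex.I := by
      simp [Complex.re_add_im]
    conv_lhs => rw [hv]
    rw [map_add, map_smul, map_smul]
    simp
  have h1 : (v.re : ℂ) = (v + conj v) / 2 := by rw [Complex.add_conj]; push_cast; ring
  have h2 : (v.im : ℂ) = -Complex.I * ((v - conj v) / 2) := by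
    rw [Complex.sub_conj]; push_cast; linear_combination (v.im : ℂ) * Complex.I_sq
  rw [h, h1, h2, dz, dzbar]
  module

theorem four_smul_dz_mul_dzbar :
    (4 : ℂ) • (dz * dzbar) = dir 1 * dir 1 + dir Complex.I * dir Complex.I := by
  have h : dir 1 * dir Complex.I = dir Complex.I * dir 1 := commute_dir 1 Complex.I
  unfold dz dzbar
  simp only [smul_mul_assoc, mul_smul_comm, add_mul, mul_add, smul_smul, h, smul_add]
  match_scalars <;> ring_nf <;> simp

theorem dir_pow_eq_sum (v : ℂ) (N : ℕ) :
    dir v ^ N = ∑ j ∈ Finset.range (N + 1),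
      (v ^ j * conj v ^ (N - j) * (N.choose j : ℂ)) • (dz ^ j * dzbar ^ (N - j)) := by
  rw [dir_eq, ((commute_dz_dzbar.smul_left v).smul_right (conj v)).add_pow]
  refine Finset.sum_congr rfl fun j _ => ?_
  rw [smul_pow, smul_pow, smul_mul_smul_comm, ← nsmul_eq_mul', ← Nat.cast_smul_eq_nsmul ℂ,
    smul_smul, mul_comm]

theorem coe_sum_apply {ι : Type*} (s : Finset ι) (F : ι → smoothFunctions) (z : ℂ) :
    ((∑ i ∈ s, F i : smoothFunctions) : ℂ → ℂ) z = ∑ i ∈ s, (F i : ℂ → ℂ) z := by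
  simp [Finset.sum_apply]

theorem dir_pow_apply_eq_sum (v : ℂ) (N : ℕ) (f : smoothFunctions) (z : ℂ) :
    ((dir v ^ N) f : ℂ → ℂ) z = ∑ j ∈ Finset.range (N + 1),
      v ^ j * conj v ^ (N - j) * (N.choose j : ℂ) *
        ((dz ^ j * dzbar ^ (N - j)) f : ℂ → ℂ) z := by
  rw [dir_pow_eq_sum, LinearMap.sum_apply, coe_sum_apply]
  rfl

theorem iteratedFDeriv_succ_apply (f : smoothFunctions) (n : ℕ) (z : ℂ) (m : Fin (n + 1) → ℂ) :
    iteratedFDeriv ℝ (n + 1) (f : ℂ → ℂ) z m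
      = iteratedFDeriv ℝ n (dir (m (Fin.last n)) f : ℂ → ℂ) z (Fin.init m) := by
  rw [iteratedFDeriv_succ_apply_right]
  exact (iteratedFDeriv_clm_apply_const_apply (contDiff_fderiv f)
    (by exact_mod_cast le_top)).symm

theorem iteratedFDeriv_apply_const (f : smoothFunctions) (n : ℕ) (z v : ℂ) :
    iteratedFDeriv ℝ n (f : ℂ → ℂ) z (fun _ => v) = ((dir v ^ n) f : ℂ → ℂ) z := by
  induction n generalizing f with
  | zero => simp
  | succ n ih =>
    rw [iteratedFDeriv_succ_apply, pow_succ]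
    exact ih (dir v f)

/-- The `n`-th derivative vanishes at a point as soon as all Wirtinger derivatives of
order `n` do. -/
theorem iteratedFDeriv_eq_zero (f : smoothFunctions) {N : ℕ} {z : ℂ}
    (hf : ∀ j ≤ N, ((dz ^ j * dzbar ^ (N - j)) f : ℂ → ℂ) z = 0) :
    iteratedFDeriv ℝ N (f : ℂ → ℂ) z = 0 := by
  have key : ∀ n j l : ℕ, n + j + l = N → ∀ m : Fin n → ℂ,
      iteratedFDeriv ℝ n ((dz ^ j * dzbar ^ l) f : ℂ → ℂ) z m = 0 := by
    intro n
    induction n with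
    | zero =>
      intro j l h m
      obtain rfl : l = N - j := by omega
      simpa using hf j (by omega)
    | succ n ih =>
      intro j l h m
      rw [iteratedFDeriv_succ_apply, dir_eq]
      generalize m (Fin.last n) = v
      have h1 : (v • dz + conj v • dzbar) ((dz ^ j * dzbar ^ l) f)
          = v • (dz ^ (j + 1) * dzbar ^ l) f + conj v • (dz ^ j * dzbar ^ (l + 1)) f := by
        have h2 : dzbar * (dz ^ j * dzbar ^ l) = dz ^ j * dzbar ^ (l + 1) := by
          rw [← mul_assoc, (commute_dz_dzbar.symm.pow_right j).eq, mul_assoc, ← pow_succ']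
        rw [← h2, pow_succ', mul_assoc]
        rfl
      rw [h1, Submodule.coe_add, Submodule.coe_smul, Submodule.coe_smul,
        iteratedFDeriv_add_apply, iteratedFDeriv_const_smul_apply,
        iteratedFDeriv_const_smul_apply]
      · rw [add_apply, smul_apply, smul_apply,
          ih (j + 1) l (by omega), ih j (l + 1) (by omega), smul_zero, smul_zero, add_zero]
      · exact (contDiff_nat _ n).contDiffAt
      · exact (contDiff_nat _ n).contDiffAt
      · exact (contDiff_nat (v • _) n).contDiffAt
      · exact (contDiff_nat (conj v • _) n).contDiffAt
  ext m
  have := key N 0 0 (by simp) m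
  simpa using this

theorem iteratedDeriv_clm_comp_smul (L : ℂ →L[ℝ] ℝ) (f : smoothFunctions) (v : ℂ) (n : ℕ)
    (t : ℝ) :
    iteratedDeriv n (fun s : ℝ => L ((f : ℂ → ℂ) (s • v))) t
      = L (((dir v ^ n) f : ℂ → ℂ) (t • v)) := by
  induction n generalizing f with
  | zero => simp
  | succ n ih =>
    have hd : deriv (fun s : ℝ => L ((f : ℂ → ℂ) (s • v)))
        = fun s : ℝ => L ((dir v f : ℂ → ℂ) (s • v)) := by
      funext s
      have h1 : HasDerivAt (fun s : ℝ => s • v) v s := by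
        simpa using (hasDerivAt_id s).smul_const v
      exact (L.hasFDerivAt.comp_hasDerivAt s
        ((differentiable f (s • v)).hasFDerivAt.comp_hasDerivAt s h1)).deriv
    rw [iteratedDeriv_succ', hd, ih, pow_succ]
    rfl

/-- The Fourier coefficients of the restriction to the unit circle of the `N`-th order
homogeneous Taylor polynomial. -/
theorem integral_dir_pow (f : smoothFunctions) (z : ℂ) {N j : ℕ} (hj : j ≤ N) :
    ∫ θ in (0 : ℝ)..(2 * Real.pi),
      ((dir (Complex.exp (θ * Complex.I)) ^ N) f : ℂ → ℂ) z
        * Complex.exp (-((2 * j - N : ℤ) * Complex.I) * θ)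
      = 2 * Real.pi * ((N.choose j : ℂ) * ((dz ^ j * dzbar ^ (N - j)) f : ℂ → ℂ) z) := by
  have hexp : ∀ (i : ℕ), i ∈ Finset.range (N + 1) → ∀ θ : ℝ,
      Complex.exp (θ * Complex.I) ^ i * conj (Complex.exp (θ * Complex.I)) ^ (N - i)
        * Complex.exp (-((2 * j - N : ℤ) * Complex.I) * θ)
      = Complex.exp (((2 * (i - j) : ℤ) * Complex.I) * θ) := by
    intro i hi θ
    have hi' : i ≤ N := Nat.lt_succ_iff.1 (Finset.mem_range.1 hi)
    rw [← Complex.exp_conj, ← Complex.exp_nat_mul, ← Complex.exp_nat_mul, ← Complex.exp_add,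
      ← Complex.exp_add]
    congr 1
    push_cast [Nat.cast_sub hi']
    simp only [map_mul, Complex.conj_ofReal, Complex.conj_I]
    ring
  have hint : ∀ i : ℕ, ∫ θ in (0 : ℝ)..(2 * Real.pi),
      Complex.exp (((2 * (i - j) : ℤ) * Complex.I) * θ) =
      if i = j then (2 * Real.pi : ℂ) else 0 := by
    intro i
    split_ifs with hij
    · simp [hij]
    · have hne : (2 * ((i : ℤ) - j)) ≠ 0 := by omega
      have hne' : ((2 * ((i : ℤ) - j) : ℤ) : ℂ) * Complex.I ≠ 0 :=
        mul_ne_zero (by exact_mod_cast hne) Complex.I_ne_zero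
      rw [integral_exp_mul_complex hne']
      have h1 : Complex.exp (((2 * ((i : ℤ) - j) : ℤ) : ℂ) * Complex.I * ((2 * Real.pi : ℝ) : ℂ))
          = 1 := by
        rw [Complex.exp_eq_one_iff]
        exact ⟨2 * ((i : ℤ) - j), by push_cast; ring⟩
      rw [h1]
      simp
  have hfun : ∀ θ : ℝ, ((dir (Complex.exp (θ * Complex.I)) ^ N) f : ℂ → ℂ) z
        * Complex.exp (-((2 * j - N : ℤ) * Complex.I) * θ)
      = ∑ i ∈ Finset.range (N + 1), Complex.exp (((2 * (i - j) : ℤ) * Complex.I) * θ)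
          * ((N.choose i : ℂ) * ((dz ^ i * dzbar ^ (N - i)) f : ℂ → ℂ) z) := by
    intro θ
    rw [dir_pow_apply_eq_sum, Finset.sum_mul]
    refine Finset.sum_congr rfl fun i hi => ?_
    rw [← hexp i hi θ]
    ring
  simp_rw [hfun]
  rw [intervalIntegral.integral_finsetSum
    fun i _ => (Continuous.intervalIntegrable (by fun_prop) _ _)]
  simp_rw [intervalIntegral.integral_mul_const, hint]
  simp [-Module.End.mul_apply, Nat.lt_succ_iff.2 hj, ite_mul]

theorem continuous_dir_pow_apply (f : smoothFunctions) (z : ℂ) (N : ℕ) :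
    Continuous fun v : ℂ => ((dir v ^ N) f : ℂ → ℂ) z := by
  simp_rw [dir_pow_apply_eq_sum]
  fun_prop

/-- A nonnegative smooth function of finite vanishing order at `0` has even vanishing order `2k`,
and `∂ᵏ∂̄ᵏ` of it is positive at `0`. -/
theorem exists_dz_pow_mul_dzbar_pow_pos (f : smoothFunctions)
    (him : ∀ z, ((f : ℂ → ℂ) z).im = 0) (hre : ∀ z, 0 ≤ ((f : ℂ → ℂ) z).re)
    {N : ℕ} (hlt : ∀ j < N, iteratedFDeriv ℝ j (f : ℂ → ℂ) 0 = 0)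
    (hN : iteratedFDeriv ℝ N (f : ℂ → ℂ) 0 ≠ 0) :
    ∃ k, N = 2 * k ∧ 0 < (((dz ^ k * dzbar ^ k) f : ℂ → ℂ) 0).re := by
  set P : ℂ → ℂ := fun v => ((dir v ^ N) f : ℂ → ℂ) 0 with hP
  have hPim : ∀ v, (P v).im = 0 := by
    intro v
    have h := iteratedDeriv_clm_comp_smul Complex.imCLM f v N 0
    simp only [Complex.imCLM_apply, him, zero_smul] at h
    rw [← h]
    simp
  have hPre : ∀ v, 0 ≤ (P v).re := by
    intro v
    have h := fun n => iteratedDeriv_clm_comp_smul Complex.reCLM f v n 0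
    simp only [Complex.reCLM_apply, zero_smul] at h
    rw [← h N]
    refine iteratedDeriv_nonneg_of_forall_lt_eq_zero ?_ (fun t => hre _) fun j hj => ?_
    · exact Complex.reCLM.contDiff.comp ((contDiff f).comp (contDiff_id.smul contDiff_const))
    · rw [h j, ← iteratedFDeriv_apply_const, hlt j hj]
      simp
  have hPcirc : ∃ θ ∈ Set.Icc 0 (2 * Real.pi), P (Complex.exp ((θ : ℝ) * Complex.I)) ≠ 0 := by
    by_contra! hzero
    refine hN (iteratedFDeriv_eq_zero f fun j hj => ?_)
    have h := integral_dir_pow f 0 hj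
    rw [intervalIntegral.integral_congr (g := fun _ => (0 : ℂ))] at h
    · have hc : (N.choose j : ℂ) ≠ 0 := by exact_mod_cast (Nat.choose_pos hj).ne'
      have hpi : (Real.pi : ℂ) ≠ 0 := by exact_mod_cast Real.pi_ne_zero
      simpa [hc, hpi] using h.symm
    · intro θ hθ
      rw [Set.uIcc_of_le (by positivity)] at hθ
      have := hzero θ hθ
      simp only [hP] at this
      simp only [this, zero_mul]
  obtain ⟨θ₀, hθ₀, hne⟩ := hPcirc
  have hpos : 0 < (P (Complex.exp (θ₀ * Complex.I))).re :=
    lt_of_le_of_ne (hPre _) fun h => hne (Complex.ext h.symm (hPim _))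
  have heven : Even N := by
    by_contra hodd
    rw [Nat.not_even_iff_odd] at hodd
    have h : P (-Complex.exp (θ₀ * Complex.I)) = -P (Complex.exp (θ₀ * Complex.I)) := by
      have hd : dir (-Complex.exp (θ₀ * Complex.I))
          = (-1 : ℂ) • dir (Complex.exp (θ₀ * Complex.I)) := by
        simp only [dir_eq, map_neg]
        module
      simp only [hP]
      rw [hd, smul_pow, hodd.neg_one_pow, LinearMap.smul_apply, Submodule.coe_smul]
      simp
    have h' := hPre (-Complex.exp (θ₀ * Complex.I))
    rw [h, Complex.neg_re] at h'
    linarith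
  obtain ⟨k, hk⟩ := heven
  obtain rfl : N = 2 * k := by omega
  refine ⟨k, rfl, ?_⟩
  have hcont : Continuous fun θ : ℝ => P (Complex.exp (θ * Complex.I)) :=
    (continuous_dir_pow_apply f 0 _).comp (by fun_prop)
  have hintpos : 0 < ∫ θ in (0 : ℝ)..(2 * Real.pi), (P (Complex.exp (θ * Complex.I))).re :=
    intervalIntegral.integral_pos (by positivity)
      (Complex.continuous_re.comp hcont).continuousOn (fun _ _ => hPre _) ⟨θ₀, hθ₀, hpos⟩
  have h := integral_dir_pow f 0 (show k ≤ 2 * k by omega)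
  have hsub : 2 * k - k = k := by omega
  have hreal : ∀ θ : ℝ, ((dir (Complex.exp (θ * Complex.I)) ^ (2 * k)) f : ℂ → ℂ) 0
        * Complex.exp (-((2 * k - (2 * k : ℕ) : ℤ) * Complex.I) * θ)
      = ((P (Complex.exp (θ * Complex.I))).re : ℂ) := by
    intro θ
    have : P (Complex.exp (θ * Complex.I)) = ((P (Complex.exp (θ * Complex.I))).re : ℂ) :=
      Complex.ext (by simp) (by simp [hPim])
    rw [← this]
    simp [hP]
  simp_rw [hreal, hsub] at h
  rw [intervalIntegral.integral_ofReal] at h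
  have h' := congrArg Complex.re h
  have hfac : (2 * Real.pi * (((2 * k).choose k : ℂ) * ((dz ^ k * dzbar ^ k) f : ℂ → ℂ) 0) : ℂ).re
      = 2 * Real.pi * (((2 * k).choose k : ℝ) * (((dz ^ k * dzbar ^ k) f : ℂ → ℂ) 0).re) := by
    rw [show (2 * Real.pi * (((2 * k).choose k : ℂ) * ((dz ^ k * dzbar ^ k) f : ℂ → ℂ) 0) : ℂ)
      = ((2 * Real.pi * ((2 * k).choose k : ℝ) : ℝ) : ℂ) * ((dz ^ k * dzbar ^ k) f : ℂ → ℂ) 0 by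
        push_cast; ring, Complex.re_ofReal_mul]
    ring
  rw [hfac, Complex.ofReal_re] at h'
  rw [h'] at hintpos
  have h1 := pos_of_mul_pos_right hintpos (by positivity)
  exact pos_of_mul_pos_right h1 (by positivity)

/-- A smooth real-valued function, viewed as complex-valued. -/
def ofReal (g : ℂ → ℝ) (hg : ContDiff ℝ ∞ g) : smoothFunctions :=
  ⟨fun z => (g z : ℂ), Complex.ofRealCLM.contDiff.comp hg⟩

theorem dir_ofReal_apply {g : ℂ → ℝ} (hg : ContDiff ℝ ∞ g) (v z : ℂ) :
    (dir v (ofReal g hg) : ℂ → ℂ) z = (fderiv ℝ g z v : ℂ) := by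
  have h := Complex.ofRealCLM.hasFDerivAt.comp z (hg.differentiable (by simp) z).hasFDerivAt
  exact congrArg (fun L : ℂ →L[ℝ] ℂ => L v) h.fderiv

theorem contDiff_lap {g : ℂ → ℝ} (hg : ContDiff ℝ ∞ g) : ContDiff ℝ ∞ (lap g) := by
  have h : ∀ {u : ℂ → ℝ} (v : ℂ), ContDiff ℝ ∞ u → ContDiff ℝ ∞ fun z => fderiv ℝ u z v :=
    fun v hu => (hu.fderiv_right (by simp)).clm_apply contDiff_const
  exact (h _ (h _ hg)).add (h _ (h _ hg))

theorem ofReal_lap {g : ℂ → ℝ} (hg : ContDiff ℝ ∞ g) :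
    ofReal (lap g) (contDiff_lap hg) = ((4 : ℂ) • (dz * dzbar)) (ofReal g hg) := by
  have h : ∀ v : ℂ, ContDiff ℝ ∞ fun z => fderiv ℝ g z v :=
    fun v => (hg.fderiv_right (by simp)).clm_apply contDiff_const
  have hd : ∀ v : ℂ, dir v (ofReal g hg) = ofReal _ (h v) :=
    fun v => Subtype.ext (funext fun z => dir_ofReal_apply hg v z)
  rw [four_smul_dz_mul_dzbar]
  refine Subtype.ext (funext fun z => ?_)
  change ((lap g z : ℝ) : ℂ) = (dir 1 (dir 1 (ofReal g hg)) : ℂ → ℂ) z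
    + (dir Complex.I (dir Complex.I (ofReal g hg)) : ℂ → ℂ) z
  rw [hd, hd, dir_ofReal_apply, dir_ofReal_apply, lap, Complex.ofReal_add]

theorem ofReal_lap_iterate {g : ℂ → ℝ} (hg : ContDiff ℝ ∞ g) (k : ℕ) (z : ℂ) :
    ((lap^[k] g z : ℝ) : ℂ) = 4 ^ k * ((dz ^ k * dzbar ^ k) (ofReal g hg) : ℂ → ℂ) z := by
  have h : ((lap^[k] g z : ℝ) : ℂ)
      = ((((4 : ℂ) • (dz * dzbar)) ^ k) (ofReal g hg) : ℂ → ℂ) z := by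
    induction k generalizing g with
    | zero => rfl
    | succ k ih =>
      rw [Function.iterate_succ_apply, ih (contDiff_lap hg), ofReal_lap hg, pow_succ]
      rfl
  rw [h, smul_pow, commute_dz_dzbar.mul_pow]
  rfl

end smoothFunctions

theorem Filter.EventuallyEq.lap {f g : ℂ → ℝ} {z : ℂ} (h : f =ᶠ[nhds z] g) :
    lap f =ᶠ[nhds z] lap g := by
  have hd : ∀ {u w : ℂ → ℝ} (v : ℂ), u =ᶠ[nhds z] w →
      (fun y => fderiv ℝ u y v) =ᶠ[nhds z] fun y => fderiv ℝ w y v :=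
    fun v huw => (huw.fderiv (𝕜 := ℝ)).mono fun y hy => by simp only [hy]
  exact (hd 1 (hd 1 h)).add (hd Complex.I (hd Complex.I h))

theorem Filter.EventuallyEq.lap_iterate {f g : ℂ → ℝ} {z : ℂ} (h : f =ᶠ[nhds z] g) (k : ℕ) :
    _root_.lap^[k] f =ᶠ[nhds z] _root_.lap^[k] g := by
  induction k generalizing f g with
  | zero => exact h
  | succ k ih => exact ih h.lap

open scoped ContDiff in
/-- A nonnegative smooth function vanishing at `0` to finite order has even vanishing order `2k`
and positive `k`-th iterated Laplacian at `0`. -/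
theorem exists_lap_iterate_pos {g : ℂ → ℝ} (hg : ContDiff ℝ ∞ g) (hnonneg : ∀ z, 0 ≤ g z)
    (h0 : g 0 = 0) (hfin : ¬ ∀ j : ℕ, iteratedFDeriv ℝ j g 0 = 0) :
    ∃ k : ℕ, 1 ≤ k ∧ (∀ j : ℕ, j < 2 * k → iteratedFDeriv ℝ j g 0 = 0) ∧
      0 < lap^[k] g 0 := by
  classical
  push Not at hfin
  have hiff : ∀ j : ℕ, iteratedFDeriv ℝ j (smoothFunctions.ofReal g hg : ℂ → ℂ) 0 = 0
      ↔ iteratedFDeriv ℝ j g 0 = 0 := by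
    intro j
    rw [← norm_eq_zero, ← norm_eq_zero (a := iteratedFDeriv ℝ j g 0)]
    exact (Complex.ofRealLI.norm_iteratedFDeriv_comp_left hg.contDiffAt
      (by exact_mod_cast le_top)).congr_left
  have hlt : ∀ j < Nat.find hfin, iteratedFDeriv ℝ j g 0 = 0 :=
    fun j hj => not_not.1 (Nat.find_min hfin hj)
  obtain ⟨k, hk, hpos⟩ := smoothFunctions.exists_dz_pow_mul_dzbar_pow_pos
    (smoothFunctions.ofReal g hg) (fun z => Complex.ofReal_im _) (fun z => hnonneg z)
    (fun j hj => (hiff j).2 (hlt j hj)) (fun h => Nat.find_spec hfin ((hiff _).1 h))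
  refine ⟨k, ?_, fun j hj => hlt j (hk ▸ hj), ?_⟩
  · by_contra! hk0
    have hspec := Nat.find_spec hfin
    obtain rfl : k = 0 := by omega
    rw [hk] at hspec
    refine hspec ?_
    ext m
    simpa using h0
  · have h := congrArg Complex.re (smoothFunctions.ofReal_lap_iterate hg k 0)
    rw [show (4 ^ k : ℂ) = ((4 ^ k : ℝ) : ℂ) by push_cast; rfl, Complex.re_ofReal_mul,
      Complex.ofReal_re] at h
    rw [h]
    positivity

open scoped ContDiff in
/-- A nonnegative function smooth on a ball agrees near the centre with a globally smooth
nonnegative function. -/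
theorem ContDiffOn.exists_contDiff_nonneg_eventuallyEq {f : ℂ → ℝ} {r : ℝ} (hr : 0 < r)
    (hf : ContDiffOn ℝ ∞ f (Metric.ball 0 r)) (hnonneg : ∀ z, 0 ≤ f z) :
    ∃ g : ℂ → ℝ, ContDiff ℝ ∞ g ∧ (∀ z, 0 ≤ g z) ∧ f =ᶠ[nhds 0] g := by
  let χ : ContDiffBump (0 : ℂ) := ⟨r / 4, r / 2, by positivity, by linarith⟩
  refine ⟨fun z => χ z * f z, contDiff_iff_contDiffAt.2 fun z => ?_,
    fun z => mul_nonneg χ.nonneg (hnonneg z), ?_⟩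
  · by_cases hz : z ∈ Metric.ball (0 : ℂ) r
    · exact χ.contDiff.contDiffAt.mul (hf.contDiffAt (Metric.isOpen_ball.mem_nhds hz))
    · have hz' : z ∉ tsupport χ := by
        rw [χ.tsupport_eq]
        intro h
        exact hz (Metric.closedBall_subset_ball (by change r / 2 < r; linarith) h)
      refine (contDiffAt_const (c := (0 : ℝ))).congr_of_eventuallyEq ?_
      filter_upwards [notMem_tsupport_iff_eventuallyEq.1 hz'] with y hy
      simp [hy]
  · filter_upwards [χ.eventuallyEq_one] with y hy
    simp [hy]

/-- if ψ : 𝔻 → ℂ^m is holomorphic with ψ(0) = 0 and h ≥ 0 is smooth with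
h(0) = 0, and h∘ψ does not vanish to infinite order at 0, then there is k ≥ 1 such that
all derivatives of h∘ψ of order < 2k vanish at 0 and Δ^k(h∘ψ)(0) > 0. -/
theorem stmt8 (m : ℕ) (ψ : ℂ → (Fin m → ℂ))
    (hψ : DifferentiableOn ℂ ψ (Metric.ball 0 1)) (hψ0 : ψ 0 = 0)
    (h : (Fin m → ℂ) → ℝ) (hsm : ContDiff ℝ (⊤ : ℕ∞) h)
    (hnonneg : ∀ x, 0 ≤ h x) (h0 : h 0 = 0)
    (hfin : ¬ ∀ j : ℕ, iteratedFDeriv ℝ j (fun ζ => h (ψ ζ)) 0 = 0) :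
    ∃ k : ℕ, 1 ≤ k ∧
      (∀ j : ℕ, j < 2 * k → iteratedFDeriv ℝ j (fun ζ => h (ψ ζ)) 0 = 0) ∧
      0 < lap^[k] (fun ζ => h (ψ ζ)) 0 := by
  have hψr : ContDiffOn ℝ (⊤ : ℕ∞) ψ (Metric.ball 0 1) :=
    (hψ.contDiffOn Metric.isOpen_ball).restrict_scalars ℝ
  obtain ⟨g, hg, hgnonneg, heq⟩ :=
    (hsm.comp_contDiffOn hψr).exists_contDiff_nonneg_eventuallyEq one_pos fun z => hnonneg _
  have hder : ∀ j : ℕ, iteratedFDeriv ℝ j (fun ζ => h (ψ ζ)) 0 = iteratedFDeriv ℝ j g 0 :=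
    fun j => (heq.iteratedFDeriv ℝ j).self_of_nhds
  have hlap : ∀ k : ℕ, lap^[k] (fun ζ => h (ψ ζ)) 0 = lap^[k] g 0 :=
    fun k => (heq.lap_iterate k).self_of_nhds
  have hg0 : g 0 = 0 := by rw [← heq.self_of_nhds, Function.comp_apply, hψ0, h0]
  simp only [hder, hlap] at hfin ⊢
  exact exists_lap_iterate_pos hg hgnonneg hg0 hfin
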